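/- arXiv:math/0405515 — 2 statements merged into one kernel-verified Lean document; each statement's English description precedes it below -/
import Mathlib

section
/- Let 𝔮 ⊆ 𝔞⁺ be a closed convex cone with vertex at the origin that contains the barycenter v in its interior. Then there exists a constant C > 0, independent of the cone 𝔮, such that ∫_{𝔮_T} ξ(t) dt ∼ C · T^{(r−1)/2} · e^{δT} as T → ∞ (i.e., the ratio of the two sides tends to 1). In particular, ∫_{𝔮_T} ξ(t) dt ∼ ∫_{(𝔞⁺)_T} ξ(t) dt as T → ∞. (Paper's Lemma 5.1 in coordinate form.) -/
open MeasureTheory Real Filter Set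

/-- anisotropic dilation: scale by `1` along `v`, by `√T` orthogonally to `v`. -/
noncomputable def coneDil {r : ℕ} (v : EuclideanSpace ℝ (Fin r)) (T : ℝ) :
    EuclideanSpace ℝ (Fin r) →ₗ[ℝ] EuclideanSpace ℝ (Fin r) :=
  √T • LinearMap.transvection (((√T)⁻¹ - 1) • (innerₗ (EuclideanSpace ℝ (Fin r)) v)) v

lemma coneDil_det {r : ℕ} (hr : 1 ≤ r) (v : EuclideanSpace ℝ (Fin r)) (hv : ‖v‖ = 1)
    (T : ℝ) (hT : 0 < T) :
    LinearMap.det (coneDil v T) = T ^ (((r : ℝ) - 1) / 2) := by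
  have h0 : 0 < √T := Real.sqrt_pos.2 hT
  unfold coneDil
  rw [LinearMap.det_smul, LinearMap.transvection.det]
  simp only [LinearMap.smul_apply, innerₗ_apply_apply, real_inner_self_eq_norm_sq, hv,
    finrank_euclideanSpace, Fintype.card_fin, smul_eq_mul]
  obtain ⟨k, rfl⟩ : ∃ k, r = k + 1 := ⟨r - 1, by omega⟩
  have : (((k + 1 : ℕ) : ℝ) - 1) / 2 = (1 / 2) * (k : ℝ) := by push_cast; ring
  rw [this, Real.rpow_mul hT.le, ← Real.sqrt_eq_rpow, Real.rpow_natCast]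
  field_simp
  ring

lemma coneDil_apply {r : ℕ} (v : EuclideanSpace ℝ (Fin r))
    (T : ℝ) (hT : 0 < T) (x : EuclideanSpace ℝ (Fin r)) :
    coneDil v T x = inner ℝ v x • v + √T • (x - inner ℝ v x • v) := by
  have h0 : √T ≠ 0 := (Real.sqrt_pos.2 hT).ne'
  simp only [coneDil, LinearMap.smul_apply, LinearMap.transvection.apply, innerₗ_apply_apply,
    smul_eq_mul]
  match_scalars <;> field_simp
  ring

lemma coneDil_inner {r : ℕ} (v : EuclideanSpace ℝ (Fin r)) (hv : ‖v‖ = 1)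
    (T : ℝ) (hT : 0 < T) (x : EuclideanSpace ℝ (Fin r)) :
    inner ℝ v (T • v + coneDil v T x) = T + inner ℝ v x := by
  rw [coneDil_apply v T hT]
  simp only [inner_add_right, inner_smul_right, inner_sub_right, real_inner_self_eq_norm_sq, hv]
  ring

lemma coneDil_norm {r : ℕ} (v : EuclideanSpace ℝ (Fin r)) (hv : ‖v‖ = 1)
    (T : ℝ) (hT : 0 < T) (x : EuclideanSpace ℝ (Fin r)) :
    ‖T • v + coneDil v T x‖ ^ 2
      = (T + inner ℝ v x) ^ 2 + T * ‖x - inner ℝ v x • v‖ ^ 2 := by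
  rw [coneDil_apply v T hT, ← add_assoc, ← add_smul, norm_add_sq_real]
  simp only [norm_smul, hv, inner_smul_right, inner_smul_left, inner_sub_right,
    real_inner_self_eq_norm_sq, mul_pow, Real.norm_eq_abs, sq_abs, Real.sq_sqrt hT.le]
  simp
  right
  ring

lemma cone_change_var {r : ℕ} (hr : 1 ≤ r) (v : EuclideanSpace ℝ (Fin r)) (hv : ‖v‖ = 1)
    (T : ℝ) (hT : 0 < T) (f : EuclideanSpace ℝ (Fin r) → ℝ) :
    ∫ t, f t = T ^ (((r : ℝ) - 1) / 2) * ∫ x, f (T • v + coneDil v T x) := by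
  have hd := coneDil_det hr v hv T hT
  have hpos : 0 < T ^ (((r : ℝ) - 1) / 2) := Real.rpow_pos_of_pos hT _
  have hne : LinearMap.det (coneDil v T) ≠ 0 := by rw [hd]; exact hpos.ne'
  have hbij : Function.Bijective (coneDil v T) := by
    have := LinearMap.equivOfDetNeZero (coneDil v T) hne |>.bijective
    exact this
  have h := integral_image_eq_integral_abs_det_fderiv_smul (volume)
    (s := univ) (f := fun x => T • v + coneDil v T x)
    (f' := fun _ => LinearMap.toContinuousLinearMap (coneDil v T)) MeasurableSet.univ
    (fun x _ => ((LinearMap.toContinuousLinearMap (coneDil v T)).hasFDerivAt.const_add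
      (T • v)).hasFDerivWithinAt)
    (fun x _ y _ hxy => hbij.1 (add_left_cancel hxy)) f
  have him : (fun x => T • v + coneDil v T x) '' univ = univ := by
    rw [image_univ, range_eq_univ]
    intro y
    obtain ⟨x, hx⟩ := hbij.2 (y - T • v)
    exact ⟨x, by simp [hx]⟩
  rw [him] at h
  simp only [Measure.restrict_univ, LinearMap.det_toContinuousLinearMap, hd,
    abs_of_pos hpos, smul_eq_mul, integral_const_mul] at h
  exact h

lemma cone_bound_integrable {r : ℕ} (δ : ℝ) (hδ : 0 < δ) :
    Integrable (fun x : EuclideanSpace ℝ (Fin r) =>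
      exp (2 * δ) * exp (-δ * (1 + ‖x‖))) := by
  refine Integrable.const_mul ?_ _
  have h1 := integrable_one_add_norm (E := EuclideanSpace ℝ (Fin r)) (μ := volume)
    (r := ((r + 1 : ℕ) : ℝ)) (by simp)
  refine (h1.const_mul (((r + 1).factorial : ℝ) / δ ^ (r + 1))).mono'
    (by fun_prop) (Eventually.of_forall fun x => ?_)
  have hy : 0 < 1 + ‖x‖ := by positivity
  rw [Real.norm_eq_abs, abs_of_pos (exp_pos _), Real.rpow_neg hy.le, Real.rpow_natCast]
  have h2 := Real.pow_div_factorial_le_exp (δ * (1 + ‖x‖)) (by positivity) (r + 1)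
  rw [neg_mul, Real.exp_neg]
  have : ((r + 1).factorial : ℝ) / δ ^ (r + 1) * ((1 + ‖x‖) ^ (r + 1))⁻¹
      = ((δ * (1 + ‖x‖)) ^ (r + 1) / ((r + 1).factorial : ℝ))⁻¹ := by
    rw [mul_pow]; field_simp
  rw [this]
  gcongr

lemma cone_exp_bound {r : ℕ} (v : EuclideanSpace ℝ (Fin r)) (hv : ‖v‖ = 1) (δ : ℝ) (hδ : 0 < δ)
    (x : EuclideanSpace ℝ (Fin r))
    (hx : 2 * inner ℝ v x + ‖x - inner ℝ v x • v‖ ^ 2 ≤ 0) :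
    exp (δ * inner ℝ v x) ≤ exp (2 * δ) * exp (-δ * (1 + ‖x‖)) := by
  have hn : ‖x‖ ^ 2 = (inner ℝ v x) ^ 2 + ‖x - inner ℝ v x • v‖ ^ 2 := by
    rw [norm_sub_sq_real, inner_smul_right, real_inner_comm, norm_smul, hv]
    simp
    ring
  set u := inner ℝ v x
  have h1 : ‖x‖ ≤ 1 - u := by
    have : 0 ≤ ‖x - u • v‖ ^ 2 := by positivity
    refine abs_le_of_sq_le_sq' (a := ‖x‖) (by nlinarith) (by linarith) |>.2
  rw [← Real.exp_add, Real.exp_le_exp]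
  nlinarith

lemma cone_null {r : ℕ} (v : EuclideanSpace ℝ (Fin r)) (hv : ‖v‖ = 1) :
    ∀ᵐ x : EuclideanSpace ℝ (Fin r), 2 * inner ℝ v x + ‖x - inner ℝ v x • v‖ ^ 2 ≠ 0 := by
  set S : Set (EuclideanSpace ℝ (Fin r)) :=
    {x | 2 * inner ℝ v x + ‖x - inner ℝ v x • v‖ ^ 2 ≤ 0} with hS
  have hconv : Convex ℝ S := by
    have hf : ConvexOn ℝ univ (fun x : EuclideanSpace ℝ (Fin r) =>
        2 * inner ℝ v x + ‖x - inner ℝ v x • v‖ ^ 2) := by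
      have hA := (convexOn_univ_norm (E := EuclideanSpace ℝ (Fin r))).pow
        (fun x _ => norm_nonneg x) 2
      have hB := hA.comp_linearMap (LinearMap.id - (innerₗ (EuclideanSpace ℝ (Fin r)) v).smulRight v)
      have hC := ((2:ℝ) • innerₗ (EuclideanSpace ℝ (Fin r)) v).convexOn (convex_univ (𝕜 := ℝ))
      have := hC.add hB
      refine this.congr ?_
      intro x _
      simp
    simpa [hS] using hf.convex_le 0
  have h0 := hconv.addHaar_frontier (μ := volume)
  rw [ae_iff]
  refine measure_mono_null ?_ h0
  intro x hx
  simp only [ne_eq, not_not, mem_ofPred_eq] at hx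
  rw [frontier_eq_closure_inter_closure]
  refine ⟨subset_closure hx.le, ?_⟩
  have hlim : Tendsto (fun e : ℝ => x + e • v) (nhdsWithin 0 (Ioi 0)) (nhds x) := by
    have : Tendsto (fun e : ℝ => x + e • v) (nhds 0) (nhds (x + (0:ℝ) • v)) :=
      (Continuous.tendsto (by fun_prop) 0)
    simp only [zero_smul, add_zero] at this
    exact this.mono_left nhdsWithin_le_nhds
  refine mem_closure_of_tendsto hlim ?_
  filter_upwards [self_mem_nhdsWithin] with e he
  simp only [mem_Ioi] at he
  simp only [hS, mem_compl_iff, mem_ofPred_eq, not_le, inner_add_right, inner_smul_right,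
    real_inner_self_eq_norm_sq, hv]
  have : x + e • v - (inner ℝ v x + e * 1 ^ 2) • v = x - inner ℝ v x • v := by module
  rw [this]
  linarith

/-- The limiting constant. -/
noncomputable def coneK {r : ℕ} (v : EuclideanSpace ℝ (Fin r)) (δ : ℝ) (c : ℝ) : ℝ :=
  ∫ x, indicator {x : EuclideanSpace ℝ (Fin r) |
    2 * inner ℝ v x + ‖x - inner ℝ v x • v‖ ^ 2 < 0} (fun x => c * exp (δ * inner ℝ v x)) x

lemma coneK_pos {r : ℕ} (v : EuclideanSpace ℝ (Fin r)) (hv : ‖v‖ = 1) (δ : ℝ) (hδ : 0 < δ)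
    (c : ℝ) (hc : 0 < c) : 0 < coneK v δ c := by
  unfold coneK
  set S : Set (EuclideanSpace ℝ (Fin r)) :=
    {x | 2 * inner ℝ v x + ‖x - inner ℝ v x • v‖ ^ 2 < 0} with hS
  have hSo : IsOpen S := isOpen_lt (by fun_prop) (by fun_prop)
  have hSn : S.Nonempty := by
    refine ⟨-v, ?_⟩
    simp [hS, hv]
  rw [integral_pos_iff_support_of_nonneg]
  · have : Function.support (S.indicator (fun x => c * exp (δ * inner ℝ v x))) = S := by
      rw [support_indicator, inter_eq_left]
      intro x _
      simp only [Function.mem_support]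
      positivity
    change 0 < volume (Function.support (S.indicator (fun x => c * exp (δ * inner ℝ v x))))
    rw [this]
    exact hSo.measure_pos _ hSn
  · intro x
    exact indicator_nonneg (fun x _ => by positivity) x
  · refine ((cone_bound_integrable δ hδ).const_mul c).mono' ?_ (Eventually.of_forall fun x => ?_)
    · exact (Continuous.aestronglyMeasurable (by fun_prop)).indicator hSo.measurableSet
    · by_cases hx : x ∈ S
      · rw [indicator_of_mem hx, Real.norm_eq_abs, abs_of_pos (by positivity)]
        have := cone_exp_bound v hv δ hδ x hx.le
        gcongr
      · rw [indicator_of_notMem hx]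
        simp; positivity

lemma sinh_eq_exp_mul (a : ℝ) : sinh a = (1 - exp (-(2 * a))) / 2 * exp a := by
  rw [Real.sinh_eq, div_mul_eq_mul_div, sub_mul, one_mul, ← Real.exp_add]
  congr 3
  ring

lemma prod_sinh_eq {ι : Type} [Fintype ι] (m : ι → ℕ) (a : ι → ℝ) :
    ∏ i, sinh (a i) ^ m i
      = (∏ i, ((1 - exp (-(2 * a i))) / 2) ^ m i) * exp (∑ i, (m i : ℝ) * a i) := by
  rw [Real.exp_sum, ← Finset.prod_mul_distrib]
  refine Finset.prod_congr rfl fun i _ => ?_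
  rw [Real.exp_nat_mul, ← mul_pow, ← sinh_eq_exp_mul]

lemma cone_scaled_tendsto {r : ℕ} (v x : EuclideanSpace ℝ (Fin r)) :
    Tendsto (fun T : ℝ => T⁻¹ • (T • v + coneDil v T x)) atTop (nhds v) := by
  have h1 : Tendsto (fun T : ℝ => T⁻¹) atTop (nhds 0) := tendsto_inv_atTop_zero
  have h2 : Tendsto (fun T : ℝ => (√T)⁻¹) atTop (nhds 0) :=
    tendsto_inv_atTop_zero.comp Real.tendsto_sqrt_atTop
  have h3 : Tendsto (fun T : ℝ => v + (T⁻¹ • (inner ℝ v x • v)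
      + (√T)⁻¹ • (x - inner ℝ v x • v))) atTop
      (nhds (v + ((0:ℝ) • (inner ℝ v x • v) + (0:ℝ) • (x - inner ℝ v x • v)))) :=
    tendsto_const_nhds.add ((h1.smul_const _).add (h2.smul_const _))
  simp only [zero_smul, add_zero] at h3
  refine h3.congr' ?_
  filter_upwards [eventually_gt_atTop 0] with T hT
  rw [coneDil_apply v T hT, smul_add, smul_add, smul_smul T⁻¹ T, smul_smul T⁻¹ (√T),
    inv_mul_cancel₀ hT.ne', one_smul]
  congr 3
  have h0 : 0 < √T := Real.sqrt_pos.2 hT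
  field_simp
  exact (Real.sq_sqrt hT.le).symm

lemma cone_key {r : ℕ} (hr : 1 ≤ r) {ι : Type} [Fintype ι]
    (α : ι → (EuclideanSpace ℝ (Fin r) →ₗ[ℝ] ℝ)) (m : ι → ℕ)
    (ξ : EuclideanSpace ℝ (Fin r) → ℝ)
    (hξ : ∀ t, ξ t = ∏ i, Real.sinh (α i t) ^ m i)
    (δ : ℝ) (hδ : 0 < δ) (v : EuclideanSpace ℝ (Fin r)) (hv : ‖v‖ = 1)
    (hρ : ∀ t, ∑ i, (m i : ℝ) * α i t = δ * inner ℝ v t)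
    (hαv : ∀ i, 0 < α i v)
    (q : Set (EuclideanSpace ℝ (Fin r))) (hqc : IsClosed q)
    (hcone : ∀ c : ℝ, 0 ≤ c → ∀ x ∈ q, c • x ∈ q)
    (hqa : ∀ t ∈ q, ∀ i, 0 ≤ α i t) (hvq : v ∈ interior q) :
    Tendsto (fun T : ℝ =>
      (∫ t in {t ∈ q | ‖t‖ < T}, ξ t) / (T ^ (((r : ℝ) - 1) / 2) * exp (δ * T)))
      atTop (nhds (coneK v δ (∏ i, (1 / 2 : ℝ) ^ m i))) := by
  have hαc : ∀ i, Continuous (α i) := fun i => (α i).continuous_of_finiteDimensional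
  have hξc : Continuous ξ := by
    have : ξ = fun t => ∏ i, Real.sinh (α i t) ^ m i := funext hξ
    rw [this]
    exact continuous_finsetProd _ fun i _ => (Real.continuous_sinh.comp (hαc i)).pow _
  have hms : ∀ T : ℝ, MeasurableSet {t ∈ q | ‖t‖ < T} := fun T =>
    hqc.measurableSet.inter (isOpen_lt continuous_norm continuous_const).measurableSet
  have hξq : ∀ t ∈ q, 0 ≤ ξ t ∧ ξ t ≤ exp (δ * inner ℝ v t) := by
    intro t ht
    have h1 : ∀ i, 0 ≤ (1 - exp (-(2 * α i t))) / 2 := fun i => by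
      have : exp (-(2 * α i t)) ≤ 1 := Real.exp_le_one_iff.2 (by linarith [hqa t ht i])
      linarith
    have h2 : ∀ i, (1 - exp (-(2 * α i t))) / 2 ≤ 1 := fun i => by
      linarith [exp_pos (-(2 * α i t))]
    rw [hξ, prod_sinh_eq, hρ]
    refine ⟨mul_nonneg (Finset.prod_nonneg fun i _ => pow_nonneg (h1 i) _) (exp_pos _).le, ?_⟩
    refine mul_le_of_le_one_left (exp_pos _).le ?_
    exact Finset.prod_le_one (fun i _ => pow_nonneg (h1 i) _)
      fun i _ => pow_le_one₀ (h1 i) (h2 i)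
  set F : ℝ → EuclideanSpace ℝ (Fin r) → ℝ := fun T x =>
    indicator {t ∈ q | ‖t‖ < T} ξ (T • v + coneDil v T x) * exp (-(δ * T)) with hF
  have hmain : Tendsto (fun T => ∫ x, F T x) atTop
      (nhds (coneK v δ (∏ i, (1 / 2 : ℝ) ^ m i))) := by
    unfold coneK
    refine tendsto_integral_filter_of_dominated_convergence
      (fun x => exp (2 * δ) * exp (-δ * (1 + ‖x‖))) ?_ ?_ (cone_bound_integrable δ hδ) ?_
    · refine Eventually.of_forall fun T => ?_
      have hmeas : Measurable (indicator {t ∈ q | ‖t‖ < T} ξ) :=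
        hξc.measurable.indicator (hms T)
      have hc : Continuous (fun x => T • v + coneDil v T x) :=
        continuous_const.add (coneDil v T).continuous_of_finiteDimensional
      exact ((hmeas.comp hc.measurable).mul_const _).aestronglyMeasurable
    · filter_upwards [eventually_gt_atTop 0] with T hT
      refine Eventually.of_forall fun x => ?_
      simp only [hF]
      by_cases hx : T • v + coneDil v T x ∈ {t ∈ q | ‖t‖ < T}
      · rw [indicator_of_mem hx]
        obtain ⟨hxq, hxT⟩ := hx
        obtain ⟨h1, h2⟩ := hξq _ hxq
        rw [Real.norm_eq_abs, abs_of_nonneg (mul_nonneg h1 (exp_pos _).le)]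
        have hn := coneDil_norm v hv T hT x
        have hsq : ‖T • v + coneDil v T x‖ ^ 2 < T ^ 2 := by
          have := norm_nonneg (T • v + coneDil v T x)
          nlinarith
        have hg : 2 * inner ℝ v x + ‖x - inner ℝ v x • v‖ ^ 2 ≤ 0 := by
          rw [hn] at hsq
          by_contra hcon
          push Not at hcon
          nlinarith [mul_pos hT hcon, sq_nonneg (inner ℝ v x)]
        refine le_trans ?_ (cone_exp_bound v hv δ hδ x hg)
        rw [coneDil_inner v hv T hT] at h2
        calc ξ (T • v + coneDil v T x) * exp (-(δ * T))
            ≤ exp (δ * (T + inner ℝ v x)) * exp (-(δ * T)) := by gcongr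
          _ = exp (δ * inner ℝ v x) := by
            rw [← Real.exp_add]; congr 1; ring
      · rw [indicator_of_notMem hx]
        simp only [zero_mul, norm_zero]
        positivity
    · filter_upwards [cone_null v hv] with x hx
      rcases lt_or_gt_of_ne hx with hneg | hpos
      · rw [indicator_of_mem (by exact hneg)]
        have hsc := cone_scaled_tendsto v x
        have hA : ∀ i, Tendsto (fun T : ℝ => α i (T • v + coneDil v T x)) atTop atTop := by
          intro i
          have h1 : Tendsto (fun T : ℝ => α i (T⁻¹ • (T • v + coneDil v T x))) atTop
              (nhds (α i v)) := ((hαc i).tendsto v).comp hsc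
          have h2 := Tendsto.atTop_mul_pos (hαv i) tendsto_id h1
          refine h2.congr' ?_
          filter_upwards [eventually_gt_atTop 0] with T hT
          rw [map_smul, smul_eq_mul, id, mul_inv_cancel_left₀ hT.ne']
        have hP : Tendsto (fun T : ℝ => ∏ i, ((1 - exp (-(2 * α i (T • v + coneDil v T x)))) / 2) ^ m i)
            atTop (nhds (∏ i, (1 / 2 : ℝ) ^ m i)) := by
          refine tendsto_finsetProd _ fun i _ => ?_
          refine Tendsto.pow ?_ _
          have h3 : Tendsto (fun T : ℝ => exp (-(2 * α i (T • v + coneDil v T x)))) atTop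
              (nhds 0) :=
            Real.tendsto_exp_neg_atTop_nhds_zero.comp
              ((hA i).const_mul_atTop (by norm_num : (0:ℝ) < 2))
          simpa using (h3.const_sub 1).div_const 2
        refine (hP.mul_const (exp (δ * inner ℝ v x))).congr' ?_
        have hu : Tendsto (fun T : ℝ => 2 * inner ℝ v x + ‖x - inner ℝ v x • v‖ ^ 2
            + (inner ℝ v x) ^ 2 * T⁻¹) atTop
            (nhds (2 * inner ℝ v x + ‖x - inner ℝ v x • v‖ ^ 2 + (inner ℝ v x) ^ 2 * 0)) :=
          tendsto_const_nhds.add (tendsto_inv_atTop_zero.const_mul _)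
        have hu' := hu.eventually_lt_const (u := 0) (by simpa using hneg)
        filter_upwards [eventually_gt_atTop 0, hu',
          hsc.eventually (mem_interior_iff_mem_nhds.1 hvq)] with T hT hlt hq
        have hmem : T • v + coneDil v T x ∈ {t ∈ q | ‖t‖ < T} := by
          refine ⟨?_, ?_⟩
          · have := hcone T hT.le _ hq
            rwa [smul_smul, mul_inv_cancel₀ hT.ne', one_smul] at this
          · refine lt_of_pow_lt_pow_left₀ 2 hT.le ?_
            rw [coneDil_norm v hv T hT]
            have h5 := mul_neg_of_pos_of_neg hT hlt
            have h6 : T * ((inner ℝ v x) ^ 2 * T⁻¹) = (inner ℝ v x) ^ 2 := by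
              field_simp
            rw [mul_add, h6] at h5
            nlinarith
        simp only [hF]
        rw [indicator_of_mem hmem, hξ, prod_sinh_eq, hρ, coneDil_inner v hv T hT, mul_assoc,
          ← Real.exp_add]
        congr 2
        ring
      · rw [indicator_of_notMem (by simp only [mem_ofPred_eq, not_lt]; exact hpos.le)]
        refine tendsto_const_nhds.congr' ?_
        filter_upwards [eventually_gt_atTop 0] with T hT
        simp only [hF]
        rw [indicator_of_notMem, zero_mul]
        rintro ⟨-, hlt⟩
        have hn := coneDil_norm v hv T hT x
        have hsq : ‖T • v + coneDil v T x‖ ^ 2 < T ^ 2 := by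
          have := norm_nonneg (T • v + coneDil v T x)
          nlinarith
        nlinarith [mul_pos hT hpos, sq_nonneg (inner ℝ v x)]
  refine hmain.congr' ?_
  filter_upwards [eventually_gt_atTop 0] with T hT
  rw [← integral_indicator (hms T), cone_change_var hr v hv T hT (indicator {t ∈ q | ‖t‖ < T} ξ)]
  simp only [hF]
  rw [integral_mul_const, Real.exp_neg]
  have := Real.rpow_pos_of_pos hT (((r : ℝ) - 1) / 2)
  have := exp_pos (δ * T)
  field_simp


/-- **Paper's Lemma 5.1 (coordinate form).**
Setup: `Φ⁺` is a finite nonempty family of nonzero linear functionals `α i` on `ℝ^r` with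
multiplicities `m i ≥ 1`; `𝔞⁺ = {t | ∀ i, α i t ≥ 0}` has nonempty interior;
`ξ t = ∏ i, sinh (α i t) ^ (m i)`; `2ρ t = ∑ i, m i * α i t`;
`δ = max {2ρ t : ‖t‖ ≤ 1}`, attained at a unique point `v` (the barycenter), which lies in the
interior of `𝔞⁺`.  Then there is a constant `C > 0`, independent of the cone, such that for every
closed convex cone `q ⊆ 𝔞⁺` with vertex at the origin containing `v` in its interior,
`∫_{q_T} ξ ∼ C · T^((r-1)/2) · e^{δT}` as `T → ∞`; in particular
`∫_{q_T} ξ ∼ ∫_{(𝔞⁺)_T} ξ` as `T → ∞`. -/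
theorem volume_asymptotics_of_cone
    (r : ℕ) (hr : 1 ≤ r)
    (ι : Type) [Fintype ι] [Nonempty ι]
    (α : ι → (EuclideanSpace ℝ (Fin r) →ₗ[ℝ] ℝ))
    (hα : ∀ i, α i ≠ 0)
    (m : ι → ℕ) (hm : ∀ i, 1 ≤ m i)
    (aPos : Set (EuclideanSpace ℝ (Fin r)))
    (haPos : aPos = {t | ∀ i, 0 ≤ α i t})
    (haPosInt : (interior aPos).Nonempty)
    (ξ : EuclideanSpace ℝ (Fin r) → ℝ)
    (hξ : ∀ t, ξ t = ∏ i, Real.sinh (α i t) ^ m i)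
    (δ : ℝ) (v : EuclideanSpace ℝ (Fin r))
    (hv_norm : ‖v‖ ≤ 1)
    (hδ : δ = ∑ i, (m i : ℝ) * α i v)
    (hmax : ∀ t : EuclideanSpace ℝ (Fin r), ‖t‖ ≤ 1 → ∑ i, (m i : ℝ) * α i t ≤ δ)
    (huniq : ∀ t : EuclideanSpace ℝ (Fin r), ‖t‖ ≤ 1 →
      (∑ i, (m i : ℝ) * α i t) = δ → t = v)
    (hv_int : v ∈ interior aPos) :
    ∃ C > (0:ℝ),
      (∀ q : Set (EuclideanSpace ℝ (Fin r)),
        IsClosed q → Convex ℝ q → (∀ c : ℝ, 0 ≤ c → ∀ x ∈ q, c • x ∈ q) →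
        q ⊆ aPos → v ∈ interior q →
        Tendsto (fun T : ℝ =>
            (∫ t in {t ∈ q | ‖t‖ < T}, ξ t) /
              (C * T ^ (((r : ℝ) - 1) / 2) * Real.exp (δ * T)))
          atTop (nhds 1)) ∧
      (∀ q : Set (EuclideanSpace ℝ (Fin r)),
        IsClosed q → Convex ℝ q → (∀ c : ℝ, 0 ≤ c → ∀ x ∈ q, c • x ∈ q) →
        q ⊆ aPos → v ∈ interior q →
        Tendsto (fun T : ℝ =>
            (∫ t in {t ∈ q | ‖t‖ < T}, ξ t) /
              (∫ t in {t ∈ aPos | ‖t‖ < T}, ξ t))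
          atTop (nhds 1)) := by

  have hαv : ∀ i, 0 < α i v := by
    intro i
    obtain ⟨x, hx⟩ : ∃ x, 0 < α i x := by
      by_contra hcon
      push Not at hcon
      apply hα i
      ext x
      have h1 := hcon x
      have h2 := hcon (-x)
      rw [map_neg] at h2
      simp only [LinearMap.zero_apply]
      linarith
    have hlim : Tendsto (fun e : ℝ => v - e • x) (nhdsWithin 0 (Ioi 0)) (nhds v) := by
      have : Tendsto (fun e : ℝ => v - e • x) (nhds 0) (nhds (v - (0:ℝ) • x)) :=
        (Continuous.tendsto (by fun_prop) 0)
      simp only [zero_smul, sub_zero] at this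
      exact this.mono_left nhdsWithin_le_nhds
    obtain ⟨e, he, he0⟩ := ((hlim.eventually (mem_interior_iff_mem_nhds.1 hv_int)).and
      self_mem_nhdsWithin).exists
    rw [haPos] at he
    have h3 : 0 ≤ α i (v - e • x) := he i
    rw [map_sub, map_smul, smul_eq_mul] at h3
    have : 0 < e * α i x := mul_pos he0 hx
    linarith
  have hδ0 : 0 < δ := by
    rw [hδ]
    refine Finset.sum_pos (fun i _ => mul_pos ?_ (hαv i)) Finset.univ_nonempty
    exact_mod_cast hm i
  let L : EuclideanSpace ℝ (Fin r) →ₗ[ℝ] ℝ := ∑ i, (m i : ℝ) • α i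
  have hL : ∀ t, L t = ∑ i, (m i : ℝ) * α i t := by
    intro t
    simp [L]
  obtain ⟨y, hy⟩ : ∃ y : EuclideanSpace ℝ (Fin r), ∀ t, L t = inner ℝ y t := by
    refine ⟨(InnerProductSpace.toDual ℝ _).symm (LinearMap.toContinuousLinearMap L), fun t => ?_⟩
    rw [InnerProductSpace.toDual_symm_apply]
    rfl
  have hvy : inner ℝ y v = δ := by rw [← hy, hL, hδ]
  have hyδ : δ ≤ ‖y‖ := by
    have h1 := real_inner_le_norm y v
    have h2 := mul_le_of_le_one_right (norm_nonneg y) hv_norm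
    linarith
  have hy0 : 0 < ‖y‖ := lt_of_lt_of_le hδ0 hyδ
  have hn1 : ‖‖y‖⁻¹ • y‖ = 1 := by
    rw [norm_smul, norm_inv, norm_norm, inv_mul_cancel₀ hy0.ne']
  have hval : ∑ i, (m i : ℝ) * α i (‖y‖⁻¹ • y) = ‖y‖ := by
    rw [← hL, hy, inner_smul_right, real_inner_self_eq_norm_sq]
    field_simp
  have hyd : ‖y‖ = δ := le_antisymm (hval ▸ hmax _ hn1.le) hyδ
  have hyv : ‖y‖⁻¹ • y = v := huniq _ hn1.le (hval.trans hyd)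
  have hv1 : ‖v‖ = 1 := by rw [← hyv, hn1]
  have hρ : ∀ t, ∑ i, (m i : ℝ) * α i t = δ * inner ℝ v t := by
    intro t
    rw [← hL, hy, ← hyv, inner_smul_left, hyd]
    simp only [map_inv₀, conj_trivial]
    field_simp
  have hc : 0 < ∏ i, (1 / 2 : ℝ) ^ m i := Finset.prod_pos fun i _ => by positivity
  set C := coneK v δ (∏ i, (1 / 2 : ℝ) ^ m i) with hC
  have hC0 : 0 < C := coneK_pos v hv1 δ hδ0 _ hc
  have main : ∀ q : Set (EuclideanSpace ℝ (Fin r)),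
        IsClosed q → (∀ c : ℝ, 0 ≤ c → ∀ x ∈ q, c • x ∈ q) →
        q ⊆ aPos → v ∈ interior q →
        Tendsto (fun T : ℝ =>
            (∫ t in {t ∈ q | ‖t‖ < T}, ξ t) /
              (C * T ^ (((r : ℝ) - 1) / 2) * Real.exp (δ * T)))
          atTop (nhds 1) := by
    intro q hqc hcone hqa hvq
    have h := cone_key hr α m ξ hξ δ hδ0 v hv1 hρ hαv q hqc hcone
      (fun t ht => by have := hqa ht; rw [haPos] at this; exact this) hvq
    have h2 := h.div_const C
    rw [← hC, div_self hC0.ne'] at h2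
    refine h2.congr fun T => ?_
    rw [div_div]
    congr 1
    ring
  refine ⟨C, hC0, fun q hqc _ hcone hqa hvq => main q hqc hcone hqa hvq, ?_⟩
  intro q hqc _ hcone hqa hvq
  have hac : IsClosed aPos := by
    rw [haPos, ofPred_forall]
    exact isClosed_iInter fun i =>
      isClosed_le continuous_const (α i).continuous_of_finiteDimensional
  have hacone : ∀ c : ℝ, 0 ≤ c → ∀ x ∈ aPos, c • x ∈ aPos := by
    intro c hc0 x hx
    rw [haPos] at hx ⊢
    intro i
    rw [map_smul, smul_eq_mul]
    exact mul_nonneg hc0 (hx i)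
  have h1 := main q hqc hcone hqa hvq
  have h2 := main aPos hac hacone subset_rfl hv_int
  have h3 := h1.div h2 one_ne_zero
  rw [div_one] at h3
  refine h3.congr' ?_
  filter_upwards [eventually_gt_atTop 0] with T hT
  have h4 := Real.rpow_pos_of_pos hT (((r : ℝ) - 1) / 2)
  have h5 : C * T ^ (((r : ℝ) - 1) / 2) * Real.exp (δ * T) ≠ 0 := by positivity
  exact div_div_div_cancel_right₀ h5 _ _
end

section
/- Let L : ℝ^r → ℝ be a nonzero linear functional, δ = max{L(t) : ‖t‖ ≤ 1}, and let v be the unique point of the closed unit ball where this maximum is attained. Let 𝔮 ⊆ ℝ^r be a closed convex cone with vertex at the origin such that v lies in the interior of 𝔮. Then there exists a constant C > 0, depending only on L and the norm (independent of the cone 𝔮), such that ∫_{𝔮_T} e^{L(t)} dt ∼ C · T^{(r−1)/2} · e^{δT} as T → ∞. (Key step (eq_dom) in the proof of the paper's Lemma 5.1.) -/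
open MeasureTheory Real Filter Set

namespace ConeAsymp

variable {E : Type*} [NormedAddCommGroup E] [InnerProductSpace ℝ E]

/-- anisotropic scaling map -/
noncomputable def amap (v : E) (b : ℝ) : E →ₗ[ℝ] E :=
  b • LinearMap.transvection ((b⁻¹ - 1) • (innerSL ℝ v : E →L[ℝ] ℝ).toLinearMap) v

lemma amap_apply (v : E) {b : ℝ} (hb : b ≠ 0) (x : E) :
    amap v b x = b • x + ((1 - b) * inner ℝ v x) • v := by
  simp only [amap, LinearMap.smul_apply, LinearMap.transvection.apply, smul_add, smul_smul]
  congr 2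
  simp
  field_simp

lemma amap_det [FiniteDimensional ℝ E] (v : E) (hv : ‖v‖ = 1) {b : ℝ} (hb : b ≠ 0)
    (n : ℕ) (hn : Module.finrank ℝ E = n + 1) :
    LinearMap.det (amap v b) = b ^ n := by
  rw [amap, LinearMap.det_smul, LinearMap.transvection.det, hn]
  simp [hv]
  field_simp
  ring

lemma norm_sq_param (v : E) (hv : ‖v‖ = 1) {b : ℝ} (hb : b ≠ 0) (x : E) :
    ‖(b ^ 2) • v - amap v b x‖ ^ 2
      = (b ^ 2 - inner ℝ v x) ^ 2 + b ^ 2 * (‖x‖ ^ 2 - (inner ℝ v x) ^ 2) := by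
  rw [amap_apply v hb, ← real_inner_self_eq_norm_sq, ← real_inner_self_eq_norm_sq]
  have hvv : inner ℝ v v = (1:ℝ) := by rw [real_inner_self_eq_norm_sq, hv]; norm_num
  simp only [inner_sub_left, inner_sub_right, inner_add_left, inner_add_right, inner_smul_left,
    inner_smul_right, real_inner_comm v x, hvv]
  simp
  ring

lemma inner_param (v : E) (hv : ‖v‖ = 1) {b : ℝ} (hb : b ≠ 0) (x : E) :
    inner ℝ v ((b ^ 2) • v - amap v b x) = b ^ 2 - inner ℝ v x := by
  have hvv : inner ℝ v v = (1:ℝ) := by rw [real_inner_self_eq_norm_sq, hv]; norm_num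
  rw [amap_apply v hb]
  simp only [inner_sub_right, inner_add_right, inner_smul_right, hvv]
  ring

/-- change of variables -/
lemma change_var [FiniteDimensional ℝ E] [MeasurableSpace E] [BorelSpace E]
    (A : E →ₗ[ℝ] E) (hA : LinearMap.det A ≠ 0) (p : E) (g : E → ℝ) :
    ∫ t, g t = |LinearMap.det A| * ∫ x, g (p - A x) := by
  have hinj : Function.Injective (fun x => p - A x) := by
    intro x y h
    have h' : A x = A y := by simpa using h
    exact (LinearEquiv.ofIsUnitDet (f := A) (v := Module.finBasis ℝ E) (v' := Module.finBasis ℝ E)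
      (by simpa using hA)).injective h'
  have hsurj : Function.Surjective (fun x => p - A x) := by
    intro y
    obtain ⟨x, hx⟩ := (LinearEquiv.ofIsUnitDet (f := A) (v := Module.finBasis ℝ E)
      (v' := Module.finBasis ℝ E) (by simpa using hA)).surjective (p - y)
    have hx' : A x = p - y := hx
    exact ⟨x, by simp [hx']⟩
  have := integral_image_eq_integral_abs_det_fderiv_smul (volume : Measure E) (s := univ)
    (f := fun x => p - A x) (f' := fun _ => - LinearMap.toContinuousLinearMap A)
    MeasurableSet.univ
    (fun x _ => by
      have h := ((LinearMap.toContinuousLinearMap A).hasFDerivAt (x := x)).const_sub p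
      exact h.hasFDerivWithinAt) hinj.injOn g
  rw [image_univ, hsurj.range_eq] at this
  simp only [Measure.restrict_univ] at this
  rw [this, ← integral_const_mul]
  congr 1
  ext x
  have : |(-LinearMap.toContinuousLinearMap A).det| = |LinearMap.det A| := by
    have h2 : (-LinearMap.toContinuousLinearMap A).det = LinearMap.det (-A) := rfl
    rw [h2, ← neg_one_smul ℝ A, LinearMap.det_smul]
    simp [abs_mul]
  rw [this, smul_eq_mul]

lemma integrable_exp_norm [FiniteDimensional ℝ E] [MeasurableSpace E] [BorelSpace E]
    [Nontrivial E] {δ : ℝ} (hδ : 0 < δ) :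
    Integrable (fun x : E => Real.exp (-δ * ‖x‖)) := by
  rw [integrable_fun_norm_addHaar (volume : Measure E) (f := fun y => Real.exp (-δ * y))]
  have := integrableOn_rpow_mul_exp_neg_mul_rpow (p := 1)
    (s := ((Module.finrank ℝ E - 1 : ℕ) : ℝ)) (b := δ)
    (by have : (0:ℝ) ≤ ((Module.finrank ℝ E - 1 : ℕ) : ℝ) := Nat.cast_nonneg _
        linarith) one_pos hδ
  simpa using this

/-- the limit region -/
def reg (v : E) : Set E := {x | ‖x‖ ^ 2 - (inner ℝ v x) ^ 2 < 2 * inner ℝ v x}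

/-- the region at parameter `b = √T` -/
def regT (v : E) (q : Set E) (b : ℝ) : Set E :=
  {x | (b ^ 2) • v - amap v b x ∈ q ∧ ‖(b ^ 2) • v - amap v b x‖ < b ^ 2}

lemma regT_sub (v : E) (hv : ‖v‖ = 1) (q : Set E) {b : ℝ} (hb : 0 < b) {x : E}
    (hx : x ∈ regT v q b) : x ∈ reg v := by
  have h1 := hx.2
  have h2 : ‖(b ^ 2) • v - amap v b x‖ ^ 2 < (b ^ 2) ^ 2 := by
    gcongr
  rw [norm_sq_param v hv hb.ne'] at h2
  have hb2 : 0 < b ^ 2 := by positivity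
  show ‖x‖ ^ 2 - (inner ℝ v x) ^ 2 < 2 * inner ℝ v x
  by_contra h
  push Not at h
  nlinarith [mul_le_mul_of_nonneg_left h hb2.le, sq_nonneg (inner ℝ v x)]

lemma reg_bound (v : E) {x : E} {δ : ℝ} (hδ : 0 < δ) (hv : ‖v‖ = 1)
    (hx : x ∈ reg v) : Real.exp (-δ * inner ℝ v x) ≤ Real.exp δ * Real.exp (-δ * ‖x‖) := by
  have hx' : ‖x‖ ^ 2 - (inner ℝ v x) ^ 2 < 2 * inner ℝ v x := hx
  have h0 : |inner ℝ v x| ≤ ‖x‖ := by simpa [hv] using abs_real_inner_le_norm v x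
  have h1 : (inner ℝ v x) ^ 2 ≤ ‖x‖ ^ 2 := by
    rw [← sq_abs]; gcongr
  have hs : 0 ≤ inner ℝ v x := by linarith
  have : ‖x‖ ≤ inner ℝ v x + 1 := by
    refine (sq_le_sq₀ (norm_nonneg x) (by linarith)).1 ?_
    nlinarith
  rw [← Real.exp_add]
  apply Real.exp_le_exp.2
  nlinarith

lemma ev_mem (v : E) (hv : ‖v‖ = 1) (q : Set E) (hcone : ∀ c : ℝ, 0 ≤ c → ∀ x ∈ q, c • x ∈ q)
    (hvq : v ∈ interior q) {x : E} (hx : x ∈ reg v) : ∀ᶠ b : ℝ in atTop, x ∈ regT v q b := by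
  have hx' : 0 < 2 * inner ℝ v x + (inner ℝ v x) ^ 2 - ‖x‖ ^ 2 := by
    have : ‖x‖ ^ 2 - (inner ℝ v x) ^ 2 < 2 * inner ℝ v x := hx
    linarith
  have hlim : Tendsto (fun b : ℝ => v - (b⁻¹ • x + ((b⁻¹ * b⁻¹ - b⁻¹) * inner ℝ v x) • v)) atTop
      (nhds (v - ((0:ℝ) • x + (((0:ℝ) * 0 - 0) * inner ℝ v x) • v))) := by
    have hi : Tendsto (fun b : ℝ => b⁻¹) atTop (nhds 0) := tendsto_inv_atTop_zero
    exact tendsto_const_nhds.sub ((hi.smul_const x).add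
      ((((hi.mul hi).sub hi).mul_const _).smul_const v))
  simp only [zero_smul, mul_zero, sub_zero, zero_mul, add_zero] at hlim
  have h1 := hlim.eventually (isOpen_interior.mem_nhds hvq)
  have h2 : ∀ᶠ b : ℝ in atTop,
      (inner ℝ v x) ^ 2 < b ^ 2 * (2 * inner ℝ v x + (inner ℝ v x) ^ 2 - ‖x‖ ^ 2) :=
    ((tendsto_pow_atTop two_ne_zero).atTop_mul_const hx').eventually_gt_atTop _
  filter_upwards [h1, h2, eventually_gt_atTop 0] with b hb1 hb2 hb
  constructor
  · have := hcone (b ^ 2) (by positivity) _ (interior_subset hb1)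
    convert this using 1
    rw [amap_apply v hb.ne', smul_sub, smul_add, smul_smul, smul_smul]
    congr 3
    · field_simp
    · field_simp
  · apply lt_of_pow_lt_pow_left₀ 2 (by positivity)
    rw [norm_sq_param v hv hb.ne']
    nlinarith

lemma measurable_amap [FiniteDimensional ℝ E] [MeasurableSpace E] [BorelSpace E] (v : E) (b : ℝ) :
    Continuous (fun x => (b ^ 2) • v - amap v b x) :=
  continuous_const.sub (LinearMap.continuous_of_finiteDimensional _)

lemma main_lim [FiniteDimensional ℝ E] [MeasurableSpace E] [BorelSpace E] [Nontrivial E]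
    (v : E) (hv : ‖v‖ = 1) {δ : ℝ} (hδ : 0 < δ)
    (q : Set E) (hq : IsClosed q) (hcone : ∀ c : ℝ, 0 ≤ c → ∀ x ∈ q, c • x ∈ q)
    (hvq : v ∈ interior q) :
    Tendsto (fun b : ℝ => ∫ x, (regT v q b).indicator (fun x => Real.exp (-δ * inner ℝ v x)) x)
      atTop (nhds (∫ x, (reg v).indicator (fun x => Real.exp (-δ * inner ℝ v x)) x)) := by
  apply tendsto_integral_filter_of_dominated_convergence
    (fun x => Real.exp δ * Real.exp (-δ * ‖x‖))
  · refine Eventually.of_forall fun b => ?_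
    apply Measurable.aestronglyMeasurable
    apply Measurable.indicator
    · exact Continuous.measurable (by fun_prop)
    · apply MeasurableSet.inter
      · exact (hq.preimage (measurable_amap v b)).measurableSet
      · exact (isOpen_lt (measurable_amap v b).norm continuous_const).measurableSet
  · filter_upwards [eventually_gt_atTop 0] with b hb
    refine Eventually.of_forall fun x => ?_
    by_cases hx : x ∈ regT v q b
    · rw [indicator_of_mem hx, Real.norm_eq_abs, abs_of_pos (Real.exp_pos _)]
      exact reg_bound v hδ hv (regT_sub v hv q hb hx)
    · rw [indicator_of_notMem hx]; simp; positivity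
  · exact (integrable_exp_norm hδ).const_mul _
  · refine Eventually.of_forall fun x => ?_
    apply tendsto_const_nhds.congr'
    by_cases hx : x ∈ reg v
    · filter_upwards [ev_mem v hv q hcone hvq hx] with b hb
      rw [indicator_of_mem hx, indicator_of_mem hb]
    · filter_upwards [eventually_gt_atTop 0] with b hb
      rw [indicator_of_notMem hx, indicator_of_notMem (fun h => hx (regT_sub v hv q hb h))]

lemma const_pos [FiniteDimensional ℝ E] [MeasurableSpace E] [BorelSpace E] [Nontrivial E]
    (v : E) (hv : ‖v‖ = 1) {δ : ℝ} (hδ : 0 < δ) :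
    0 < ∫ x, (reg v).indicator (fun x => Real.exp (-δ * inner ℝ v x)) x := by
  have hopen : IsOpen (reg v) := isOpen_lt (by fun_prop) (by fun_prop)
  have hvv : inner ℝ v v = (1:ℝ) := by rw [real_inner_self_eq_norm_sq, hv]; norm_num
  rw [integral_pos_iff_support_of_nonneg]
  · have : Function.support ((reg v).indicator (fun x => Real.exp (-δ * inner ℝ v x))) = reg v := by
      ext x; simp [Real.exp_ne_zero]
    rw [this]
    refine hopen.measure_pos volume ⟨v, ?_⟩
    show ‖v‖ ^ 2 - (inner ℝ v v) ^ 2 < 2 * inner ℝ v v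
    rw [hvv, hv]; norm_num
  · exact fun x => indicator_nonneg (fun _ _ => (Real.exp_pos _).le) x
  · apply ((integrable_exp_norm (E := E) hδ).const_mul (Real.exp δ)).mono'
    · apply Measurable.aestronglyMeasurable
      apply Measurable.indicator _ hopen.measurableSet
      exact Continuous.measurable (by fun_prop)
    · refine Eventually.of_forall fun x => ?_
      by_cases hx : x ∈ reg v
      · rw [indicator_of_mem hx, Real.norm_eq_abs, abs_of_pos (Real.exp_pos _)]
        exact reg_bound v hδ hv hx
      · rw [indicator_of_notMem hx]; simp; positivity

lemma integral_eq [FiniteDimensional ℝ E] [MeasurableSpace E] [BorelSpace E]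
    (n : ℕ) (hn : Module.finrank ℝ E = n + 1)
    (v : E) (hv : ‖v‖ = 1) (δ : ℝ) (L : E → ℝ) (hL : ∀ t, L t = δ * inner ℝ v t)
    (q : Set E) (hq : IsClosed q) {b : ℝ} (hb : 0 < b) :
    ∫ t in {t ∈ q | ‖t‖ < b ^ 2}, Real.exp (L t)
      = b ^ n * Real.exp (δ * b ^ 2) *
        ∫ x, (regT v q b).indicator (fun x => Real.exp (-δ * inner ℝ v x)) x := by
  have hm : MeasurableSet {t ∈ q | ‖t‖ < b ^ 2} :=
    hq.measurableSet.inter (isOpen_lt continuous_norm continuous_const).measurableSet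
  have hdet := amap_det v hv hb.ne' n hn
  rw [← integral_indicator hm, change_var (amap v b) (by rw [hdet]; positivity) ((b ^ 2) • v),
    hdet, abs_of_pos (by positivity), mul_assoc, ← integral_const_mul (Real.exp _)]
  congr 2
  ext x
  by_cases hx : x ∈ regT v q b
  · have hx2 : (b ^ 2) • v - amap v b x ∈ {t ∈ q | ‖t‖ < b ^ 2} := hx
    rw [indicator_of_mem hx, indicator_of_mem hx2, hL, inner_param v hv hb.ne', ← Real.exp_add]
    congr 1; ring
  · have hx2 : (b ^ 2) • v - amap v b x ∉ {t ∈ q | ‖t‖ < b ^ 2} := hx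
    rw [indicator_of_notMem hx, indicator_of_notMem hx2, mul_zero]

end ConeAsymp

/-- **Key step (eq_dom) in the proof of the paper's Lemma 5.1.**
Let `L` be a nonzero linear functional on `ℝ^r`, `δ = max {L t : ‖t‖ ≤ 1}` (for the
inner-product norm of `EuclideanSpace`), attained at the unique point `v` of the closed unit
ball.  Then there exists `C > 0`, depending only on `L` and the norm (independent of the cone),
such that for every closed convex cone `q` with vertex at the origin containing `v` in its
interior, `∫_{q_T} e^{L t} dt ∼ C · T^((r-1)/2) · e^{δT}` as `T → ∞`. -/
theorem exp_integral_asymptotics_of_cone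
    (r : ℕ) (hr : 1 ≤ r)
    (L : EuclideanSpace ℝ (Fin r) →ₗ[ℝ] ℝ) (hL : L ≠ 0)
    (δ : ℝ) (v : EuclideanSpace ℝ (Fin r))
    (hv_norm : ‖v‖ ≤ 1)
    (hδ : δ = L v)
    (hmax : ∀ t : EuclideanSpace ℝ (Fin r), ‖t‖ ≤ 1 → L t ≤ δ)
    (huniq : ∀ t : EuclideanSpace ℝ (Fin r), ‖t‖ ≤ 1 → L t = δ → t = v) :
    ∃ C > (0:ℝ),
      ∀ q : Set (EuclideanSpace ℝ (Fin r)),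
        IsClosed q → Convex ℝ q → (∀ c : ℝ, 0 ≤ c → ∀ x ∈ q, c • x ∈ q) →
        v ∈ interior q →
        Tendsto (fun T : ℝ =>
            (∫ t in {t ∈ q | ‖t‖ < T}, Real.exp (L t)) /
              (C * T ^ (((r : ℝ) - 1) / 2) * Real.exp (δ * T)))
          atTop (nhds 1) := by
  obtain ⟨n, rfl⟩ : ∃ n, r = n + 1 := ⟨r - 1, by omega⟩
  obtain ⟨a, ha⟩ : ∃ a : EuclideanSpace ℝ (Fin (n + 1)), ∀ t, L t = inner ℝ a t :=
    ⟨(InnerProductSpace.toDual ℝ _).symm (LinearMap.toContinuousLinearMap L), fun t => by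
      rw [InnerProductSpace.toDual_symm_apply]; rfl⟩
  have ha0 : a ≠ 0 := by
    rintro rfl
    exact hL (LinearMap.ext fun t => by simp [ha])
  have hna : 0 < ‖a‖ := norm_pos_iff.2 ha0
  have hu : ‖‖a‖⁻¹ • a‖ = 1 := by rw [norm_smul, norm_inv, norm_norm]; field_simp
  have hLu : L (‖a‖⁻¹ • a) = ‖a‖ := by
    rw [ha, inner_smul_right, real_inner_self_eq_norm_sq]; field_simp
  have hδa : δ = ‖a‖ := by
    apply le_antisymm
    · rw [hδ, ha]
      calc inner ℝ a v ≤ ‖a‖ * ‖v‖ := real_inner_le_norm _ _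
        _ ≤ ‖a‖ * 1 := by gcongr
        _ = ‖a‖ := mul_one _
    · rw [← hLu]; exact hmax _ hu.le
  have huv := huniq _ hu.le (hLu.trans hδa.symm)
  have hv : ‖v‖ = 1 := by rw [← huv, hu]
  have hδ0 : 0 < δ := hδa ▸ hna
  have hLt : ∀ t, L t = δ * inner ℝ v t := fun t => by
    rw [ha, hδa, ← huv, inner_smul_left]
    simp only [conj_trivial]
    field_simp
  have hC := ConeAsymp.const_pos v hv hδ0
  refine ⟨_, hC, fun q hq _ hcone hvq => ?_⟩
  have hlim := (ConeAsymp.main_lim v hv hδ0 q hq hcone hvq).comp tendsto_sqrt_atTop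
  have hlim2 := hlim.div_const
    (∫ x, (ConeAsymp.reg v).indicator (fun x => Real.exp (-δ * inner ℝ v x)) x)
  rw [div_self hC.ne'] at hlim2
  refine hlim2.congr' ?_
  filter_upwards [eventually_gt_atTop 0] with T hT
  have hb : 0 < √T := Real.sqrt_pos.2 hT
  have hbT : (√T) ^ 2 = T := Real.sq_sqrt hT.le
  have hI := ConeAsymp.integral_eq n (by simp) v hv δ L hLt q hq hb
  rw [hbT] at hI
  have hpow : T ^ ((((n + 1 : ℕ) : ℝ) - 1) / 2) = (√T) ^ n := by
    rw [Real.sqrt_eq_rpow, ← Real.rpow_natCast, ← Real.rpow_mul hT.le]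
    congr 1; push_cast; ring
  rw [hI, hpow]
  simp only [Function.comp]
  have h1 : (√T) ^ n ≠ 0 := by positivity
  have h2 : Real.exp (δ * T) ≠ 0 := Real.exp_ne_zero _
  field_simp
end
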